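/- arXiv:2411.09074 — 2 statements merged into one kernel-verified Lean document; each statement's English description precedes it below -/
import Mathlib

section
/- Let D be an sDAG on a taxon set X that has all compatible edges, let D' be the sDAG obtained by applying to D the NNI at an edge t → s (with t = {X ∪ Y, Z}, s = {X, Y}) swapping Y and Z, and let t' → s' be the central edge. Suppose τ' is a topology in D' containing the central edge, with neighboring edges u → t', t' → y, s' → x, s' → z in τ' (where ∪(y) = Y, ∪(x) = X, ∪(z) = Z). Then the graph τ obtained from τ' by removing t' and s' and their five incident edges and adding the nodes t and s and the edges u → t, t → s, t → z, s → x, and s → y is a topology in D, and τ' is an NNI of τ. -/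
namespace Phylo

variable {α : Type*} [DecidableEq α]

/-- A node of an sDAG: a finite set of clades (subsets of the taxon set).
A proper subsplit is such a set with exactly two clades; the root node `{X}`
and the leaf nodes `{{x}}` have a single clade. -/
abbrev SNode (α : Type*) := Finset (Finset α)

/-- `∪(t)`: the union of the clades of a node. -/
def cladeUnion (t : SNode α) : Finset α := t.sup id

/-- A directed graph whose vertices are sDAG nodes, given by plain data. -/
structure Digraph (α : Type*) where
  nodes : Set (SNode α)
  edges : Set (SNode α × SNode α)

/-- A valid node on the taxon set `X`: its clades are nonempty pairwise disjoint
subsets of `X`, and it has either two clades (a proper subsplit) or one clade,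
in which case it is the root `{X}` or a leaf `{{x}}`. -/
def IsValidNode (X : Finset α) (t : SNode α) : Prop :=
  (∀ A ∈ t, A ⊆ X) ∧ (∀ A ∈ t, A.Nonempty) ∧
  (∀ A ∈ t, ∀ B ∈ t, A ≠ B → Disjoint A B) ∧
  (t.card = 1 ∨ t.card = 2) ∧
  (t.card = 1 → t = ({X} : SNode α) ∨ ∃ x, t = ({({x} : Finset α)} : SNode α))

/-- A leaf node `{{x}}`. -/
def IsLeafNode (t : SNode α) : Prop := ∃ x, t = ({({x} : Finset α)} : SNode α)

/-- `s` is a compatible child of `t`: `∪(s)` equals one of the clades of `t`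
(the inequality `s ≠ t` only excludes the degenerate self-loops at single-clade
nodes, where a node would trivially partition its own unique clade). -/
def CompatibleChild (t s : SNode α) : Prop := cladeUnion s ∈ t ∧ s ≠ t

/-- `D` is an sDAG on the taxon set `X`. -/
def IsSDag (X : Finset α) (D : Digraph α) : Prop :=
  ({X} : SNode α) ∈ D.nodes ∧
  (∀ x ∈ X, ({({x} : Finset α)} : SNode α) ∈ D.nodes) ∧
  (∀ t ∈ D.nodes, IsValidNode X t) ∧
  (∀ e ∈ D.edges, e.1 ∈ D.nodes ∧ e.2 ∈ D.nodes ∧ CompatibleChild e.1 e.2)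

/-- `τ` is a subgraph of `D`. -/
def Subgraph (τ D : Digraph α) : Prop := τ.nodes ⊆ D.nodes ∧ τ.edges ⊆ D.edges

/-- `τ` is (the sDAG representation of) a rooted bifurcating topology on `X`:
a tree-structured sDAG in which every non-leaf node has, for each of its clades,
exactly one outgoing edge to a node partitioning that clade, and every non-root
node has exactly one parent edge. -/
def IsTopology (X : Finset α) (τ : Digraph α) : Prop :=
  IsSDag X τ ∧
  (∀ t ∈ τ.nodes, ¬ IsLeafNode t →
    ∀ C ∈ t, ∃! s : SNode α, (t, s) ∈ τ.edges ∧ cladeUnion s = C) ∧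
  (∀ s ∈ τ.nodes, s ≠ ({X} : SNode α) → ∃! t : SNode α, (t, s) ∈ τ.edges)

/-- `τ` is a topology in the sDAG `D`. -/
def IsTopologyIn (X : Finset α) (D τ : Digraph α) : Prop :=
  IsTopology X τ ∧ Subgraph τ D

/-- `D` has edges between all compatible subsplits. -/
def AllCompatibleEdges (D : Digraph α) : Prop :=
  ∀ t ∈ D.nodes, ∀ s ∈ D.nodes, CompatibleChild t s → (t, s) ∈ D.edges

/-- The sDAG obtained from `D` by the NNI at the edge `{A ∪ B, C} → {A, B}`
swapping the clades `B` and `C`.  The new nodes are `t' = {A ∪ C, B}` and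
`s' = {A, C}`, and the new edges are the central edge `t' → s'`, the edges
`u → t'` for every edge `u → t` of `D`, and the leafward edges from `s'`
(resp. `t'`) to the children of the old nodes partitioning subsets of `A`, `C`
(resp. `B`). -/
def nniEnlarge (D : Digraph α) (A B C : Finset α) : Digraph α where
  nodes := D.nodes ∪ {({A ∪ C, B} : SNode α), ({A, C} : SNode α)}
  edges := D.edges ∪ {e : SNode α × SNode α |
      e = (({A ∪ C, B} : SNode α), ({A, C} : SNode α))
    ∨ (∃ u, (u, ({A ∪ B, C} : SNode α)) ∈ D.edges ∧ e = (u, ({A ∪ C, B} : SNode α)))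
    ∨ (∃ u, (({A, B} : SNode α), u) ∈ D.edges ∧ cladeUnion u ⊆ A ∧
        e = (({A, C} : SNode α), u))
    ∨ (∃ u, (({A, B} : SNode α), u) ∈ D.edges ∧ cladeUnion u ⊆ B ∧
        e = (({A ∪ C, B} : SNode α), u))
    ∨ (∃ u, (({A ∪ B, C} : SNode α), u) ∈ D.edges ∧ cladeUnion u ⊆ C ∧
        e = (({A, C} : SNode α), u)) }

/-- The NNI at the edge `{A ∪ B, C} → {A, B}` swapping `B` and `C` is applicable
to `D`: the clades are nonempty and pairwise disjoint and the edge is in `D`. -/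
def NNIApplicable (D : Digraph α) (A B C : Finset α) : Prop :=
  A.Nonempty ∧ B.Nonempty ∧ C.Nonempty ∧
  Disjoint A B ∧ Disjoint A C ∧ Disjoint B C ∧
  ((({A ∪ B, C} : SNode α)), (({A, B}) : SNode α)) ∈ D.edges

/-- The nearest-neighbor interchange on a topology `τ` at the edge
`{A ∪ B, C} → {A, B}`, swapping `B` and `C`: the nodes `{A ∪ B, C}` and `{A, B}`
and their incident edges are removed and replaced by `{A ∪ C, B}` and `{A, C}`,
rewiring the three subtrees on `A`, `B`, `C` accordingly and leaving the rest
of `τ` unchanged. -/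
def nniSwapTop (τ : Digraph α) (A B C : Finset α) : Digraph α where
  nodes := (τ.nodes \ {({A ∪ B, C} : SNode α), ({A, B} : SNode α)}) ∪
    {({A ∪ C, B} : SNode α), ({A, C} : SNode α)}
  edges := {e ∈ τ.edges | e.1 ≠ ({A ∪ B, C} : SNode α) ∧ e.1 ≠ ({A, B} : SNode α) ∧
      e.2 ≠ ({A ∪ B, C} : SNode α) ∧ e.2 ≠ ({A, B} : SNode α)} ∪
    {e : SNode α × SNode α |
      e = (({A ∪ C, B} : SNode α), ({A, C} : SNode α))
    ∨ (∃ u, (u, ({A ∪ B, C} : SNode α)) ∈ τ.edges ∧ e = (u, ({A ∪ C, B} : SNode α)))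
    ∨ (∃ u, (({A, B} : SNode α), u) ∈ τ.edges ∧ cladeUnion u ⊆ A ∧
        e = (({A, C} : SNode α), u))
    ∨ (∃ u, (({A, B} : SNode α), u) ∈ τ.edges ∧ cladeUnion u ⊆ B ∧
        e = (({A ∪ C, B} : SNode α), u))
    ∨ (∃ u, (({A ∪ B, C} : SNode α), u) ∈ τ.edges ∧ cladeUnion u ⊆ C ∧
        e = (({A, C} : SNode α), u)) }

/-- `τ'` is an NNI of the topology `τ`: `τ'` is obtained from `τ` by a
nearest-neighbor interchange at some edge `{A ∪ B, C} → {A, B}` of `τ`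
(both NNIs at this edge are captured, by the symmetry of the data in `A`, `B`). -/
def IsNNIOf (τ' τ : Digraph α) : Prop :=
  ∃ A B C : Finset α, A.Nonempty ∧ B.Nonempty ∧ C.Nonempty ∧
    Disjoint A B ∧ Disjoint A C ∧ Disjoint B C ∧
    (({A ∪ B, C} : SNode α), ({A, B} : SNode α)) ∈ τ.edges ∧
    τ' = nniSwapTop τ A B C

/-- Rooted binary trees with taxa at the leaves. -/
inductive BT (α : Type*) where
  | lf : α → BT α
  | nd : BT α → BT α → BT α

/-- The taxon set of a rooted binary tree. -/
def BT.taxa : BT α → Finset α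
  | .lf x => {x}
  | .nd l r => l.taxa ∪ r.taxa

/-- The sDAG node (subsplit) associated to the root of a rooted binary tree. -/
def BT.subsplit : BT α → SNode α
  | .lf x => ({({x} : Finset α)} : SNode α)
  | .nd l r => ({l.taxa, r.taxa} : SNode α)

/-- The subsplits occurring in a rooted binary tree. -/
def BT.sdagNodes : BT α → Set (SNode α)
  | .lf x => {({({x} : Finset α)} : SNode α)}
  | .nd l r => insert (({l.taxa, r.taxa} : SNode α)) (BT.sdagNodes l ∪ BT.sdagNodes r)

/-- The parent-child subsplit edges of a rooted binary tree. -/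
def BT.sdagEdges : BT α → Set (SNode α × SNode α)
  | .lf _ => ∅
  | .nd l r =>
      insert ((({l.taxa, r.taxa} : SNode α), l.subsplit))
        (insert ((({l.taxa, r.taxa} : SNode α), r.subsplit))
          (BT.sdagEdges l ∪ BT.sdagEdges r))

/-- The sDAG representation of a rooted binary tree, including the root node. -/
def BT.toDigraph (t : BT α) : Digraph α where
  nodes := insert ({t.taxa} : SNode α) t.sdagNodes
  edges := insert (({t.taxa} : SNode α), t.subsplit) t.sdagEdges

/-- The union of two digraphs (the sDAG generated by two sDAGs). -/
def Digraph.union (D E : Digraph α) : Digraph α := ⟨D.nodes ∪ E.nodes, D.edges ∪ E.edges⟩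


theorem cladeUnion_pair (P Q : Finset α) : cladeUnion ({P, Q} : SNode α) = P ∪ Q := by
  simp [cladeUnion]

theorem subset_cladeUnion {t : SNode α} {K : Finset α} (h : K ∈ t) : K ⊆ cladeUnion t :=
  Finset.le_sup (f := id) h

theorem cladeUnion_subset {X : Finset α} {t : SNode α} (h : IsValidNode X t) :
    cladeUnion t ⊆ X :=
  Finset.sup_le (f := id) h.1

theorem mem_cladeUnion {t : SNode α} {a : α} : a ∈ cladeUnion t ↔ ∃ K ∈ t, a ∈ K := by
  simp [cladeUnion, Finset.mem_sup]

theorem valid_eq_of_mem {X : Finset α} {t : SNode α} (h : IsValidNode X t) {K L : Finset α}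
    (hK : K ∈ t) (hL : L ∈ t) {a : α} (ha : a ∈ K) (hb : a ∈ L) : K = L := by
  by_contra hne
  exact Finset.disjoint_left.1 (h.2.2.1 K hK L hL hne) ha hb

/-- A child of a leaf cannot exist. -/
theorem no_leaf_child {X : Finset α} {t s : SNode α} (ht : IsLeafNode t) (hs : IsValidNode X s)
    (h : CompatibleChild t s) : False := by
  obtain ⟨x, rfl⟩ := ht
  obtain ⟨h1, h2⟩ := h
  have h1 : cladeUnion s = {x} := by simpa using h1
  apply h2
  have hall : ∀ K ∈ s, K = {x} := by
    intro K hK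
    have := subset_cladeUnion hK
    rw [h1] at this
    exact (Finset.subset_singleton_iff.1 this).resolve_left (hs.2.1 K hK).ne_empty
  have hne : s.Nonempty := by
    rw [← Finset.card_pos]; have := hs.2.2.2.1; omega
  exact Finset.eq_singleton_iff_nonempty_unique_mem.2 ⟨hne, hall⟩

/-- A non-root parent has strictly larger clade union. -/
theorem parent_lt {X : Finset α} {t s : SNode α} (htv : IsValidNode X t) (hs : IsValidNode X s)
    (h : CompatibleChild t s) (hr : t ≠ {X}) : cladeUnion s ⊂ cladeUnion t := by
  have hsub := subset_cladeUnion h.1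
  refine hsub.ssubset_of_ne ?_
  intro heq
  have hc : t.card = 1 := by
    rw [Finset.card_eq_one]
    refine ⟨cladeUnion s, Finset.eq_singleton_iff_unique_mem.2 ⟨h.1, ?_⟩⟩
    intro K hK
    obtain ⟨a, ha⟩ := htv.2.1 K hK
    exact valid_eq_of_mem htv hK h.1 ha (heq ▸ subset_cladeUnion hK ha)
  rcases htv.2.2.2.2 hc with h' | h'
  · exact hr h'
  · exact no_leaf_child h' hs h

/-- Laminarity of the nodes of a topology. -/
theorem laminar {X : Finset α} {T : Digraph α} (hT : IsTopology X T) (a : α) :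
    ∀ (k : ℕ) (m n : SNode α), m ∈ T.nodes → n ∈ T.nodes → m ≠ {X} → n ≠ {X} →
      a ∈ cladeUnion m → a ∈ cladeUnion n →
      2 * X.card ≤ k + ((cladeUnion m).card + (cladeUnion n).card) →
      m = n ∨ (∃ K ∈ n, cladeUnion m ⊆ K) ∨ (∃ K ∈ m, cladeUnion n ⊆ K) := by
  obtain ⟨⟨_, _, hV, hE⟩, hC, hP⟩ := hT
  -- uniqueness of children
  have huc : ∀ p m n, (p, m) ∈ T.edges → (p, n) ∈ T.edges → cladeUnion m = cladeUnion n →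
      m = n := by
    intro p m n h1 h2 h3
    obtain ⟨hp, hm, hc⟩ := hE _ h1
    have hl : ¬ IsLeafNode p := fun hl => no_leaf_child hl (hV _ hm) hc
    exact (hC p hp hl _ hc.1).unique ⟨h1, rfl⟩ ⟨h2, h3.symm⟩
  intro k
  induction k using Nat.strong_induction_on with
  | _ k ih =>
  -- the case in which the first node is the smaller one
  have key : ∀ m n : SNode α, m ∈ T.nodes → n ∈ T.nodes → m ≠ {X} → n ≠ {X} →
      a ∈ cladeUnion m → a ∈ cladeUnion n →
      2 * X.card ≤ k + ((cladeUnion m).card + (cladeUnion n).card) →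
      (cladeUnion m).card ≤ (cladeUnion n).card →
      m = n ∨ (∃ K ∈ n, cladeUnion m ⊆ K) ∨ (∃ K ∈ m, cladeUnion n ⊆ K) := by
    intro m n hm hn hmr hnr ham han hk hle
    obtain ⟨p, hp, -⟩ := hP m hm hmr
    obtain ⟨q, hq, -⟩ := hP n hn hnr
    obtain ⟨hpn, _, hpc⟩ := hE _ hp
    obtain ⟨hqn, _, hqc⟩ := hE _ hq
    dsimp only at hpn hpc hqn hqc
    have hmX := cladeUnion_subset (hV m hm)
    have hnX := cladeUnion_subset (hV n hn)
    have hpX := cladeUnion_subset (hV p hpn)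
    have hqX := cladeUnion_subset (hV q hqn)
    have cm := Finset.card_le_card hmX
    have cn := Finset.card_le_card hnX
    have cp := Finset.card_le_card hpX
    have cq := Finset.card_le_card hqX
    by_cases hpr : p = {X}
    · have hmu : cladeUnion m = X := by have := hpc.1; rw [hpr] at this; simpa using this
      have hnu : cladeUnion n = X := by
        apply Finset.eq_of_subset_of_card_le hnX
        rw [hmu] at hle; exact hle
      by_cases hqr : q = {X}
      · left
        subst hpr
        subst hqr
        exact huc _ m n hp hq (hmu.trans hnu.symm)
      · have := Finset.card_lt_card (parent_lt (hV q hqn) (hV n hn) hqc hqr)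
        rw [hnu] at this
        omega
    · have hlt := parent_lt (hV p hpn) (hV m hm) hpc hpr
      have hltc := Finset.card_lt_card hlt
      rcases ih (k - 1) (by omega) p n hpn hn hpr hnr (hlt.1 ham) han (by omega) with
        h | ⟨K, hK, h⟩ | ⟨K, hK, h⟩
      · subst h
        exact Or.inr (Or.inl ⟨_, hpc.1, Finset.Subset.refl _⟩)
      · exact Or.inr (Or.inl ⟨K, hK, hlt.1.trans h⟩)
      · have hKe : K = cladeUnion m := valid_eq_of_mem (hV p hpn) hK hpc.1 (h han) ham
        subst hKe
        have heq : cladeUnion n = cladeUnion m := Finset.eq_of_subset_of_card_le h hle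
        by_cases hqr : q = {X}
        · have hnu : cladeUnion n = X := by
            have := hqc.1; rw [hqr] at this; simpa using this
          rw [← heq, hnu] at hltc
          omega
        · have hlt2 := parent_lt (hV q hqn) (hV n hn) hqc hqr
          have hlt2c := Finset.card_lt_card hlt2
          rcases ih (k - 2) (by omega) p q hpn hqn hpr hqr (hlt.1 ham) (hlt2.1 han)
            (by omega) with h' | ⟨K, hK, h'⟩ | ⟨K, hK, h'⟩
          · subst h'
            exact Or.inl (huc _ m n hp hq heq.symm)
          · have : K = cladeUnion n :=
              valid_eq_of_mem (hV q hqn) hK hqc.1 (h' (hlt.1 ham)) han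
            subst this
            have := Finset.card_le_card h'
            rw [heq] at this
            omega
          · have : K = cladeUnion m :=
              valid_eq_of_mem (hV p hpn) hK hpc.1 (h' (hlt2.1 han)) ham
            subst this
            have := Finset.card_le_card h'
            rw [← heq] at this
            omega
  intro m n hm hn hmr hnr ham han hk
  rcases le_total (cladeUnion m).card (cladeUnion n).card with h | h
  · exact key m n hm hn hmr hnr ham han hk h
  · rcases key n m hn hm hnr hmr han ham (by omega) h with h | h | h
    · exact Or.inl h.symm
    · exact Or.inr (Or.inr h)
    · exact Or.inr (Or.inl h)

/-- The combinatorial core, in terms of abstract nodes. -/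
theorem core (X : Finset α) (D : Digraph α)
    (hD : IsSDag X D) (hall : AllCompatibleEdges D) (T : Digraph α) (hT : IsTopology X T)
    (t s t' s' u x y z : SNode α) (A B C : Finset α)
    (hTD : ∀ n ∈ T.nodes, n ≠ t' → n ≠ s' → n ∈ D.nodes)
    (htD : t ∈ D.nodes) (hsD : s ∈ D.nodes)
    (htN : t ∉ T.nodes) (hsN : s ∉ T.nodes) (hts : t ≠ s)
    (ht : t = {A ∪ B, C}) (hs : s = {A, B})
    (ut : cladeUnion t = cladeUnion t')
    (us : cladeUnion s = A ∪ B)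
    (nt' : t'.card = 2) (ns' : s'.card = 2) (nt : t.card = 2) (ns : s.card = 2)
    (hAB : A ≠ B) (hAC : A ≠ C) (hBC : B ≠ C) (hABC : A ∪ B ≠ C)
    (ux : cladeUnion x = A) (uy : cladeUnion y = B) (uz : cladeUnion z = C)
    (ets : (t', s') ∈ T.edges) (eu : (u, t') ∈ T.edges) (ey : (t', y) ∈ T.edges)
    (ex : (s', x) ∈ T.edges) (ez : (s', z) ∈ T.edges)
    (cht : ∀ w, (t', w) ∈ T.edges → w = s' ∨ w = y)
    (chs : ∀ w, (s', w) ∈ T.edges → w = x ∨ w = z)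
    (par : ∀ p q w, (p, w) ∈ T.edges → (q, w) ∈ T.edges → p = q)
    (hus : u ≠ s') (hut : u ≠ t') (hyt : y ≠ t') (hys : y ≠ s')
    (hxt : x ≠ t') (hxs : x ≠ s') (hzt : z ≠ t') (hzs : z ≠ s') :
    IsTopologyIn X D ⟨(T.nodes \ {t', s'}) ∪ {t, s},
      {e ∈ T.edges | e.1 ≠ t' ∧ e.1 ≠ s' ∧ e.2 ≠ t' ∧ e.2 ≠ s'} ∪
        {(u, t), (t, s), (t, z), (s, x), (s, y)}⟩ := by
  obtain ⟨⟨hR, hL, hV, hE⟩, hC, hP⟩ := hT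
  have card1 : ∀ K : Finset α, ({K} : SNode α).card = 1 := fun K => Finset.card_singleton K
  have leafcard : ∀ n : SNode α, IsLeafNode n → n.card = 1 := by
    rintro n ⟨a, rfl⟩; exact card1 _
  have nu := (hE _ eu).1
  have ny := (hE _ ey).2.1
  have nx := (hE _ ex).2.1
  have nz := (hE _ ez).2.1
  have hnodes : ∀ n ∈ (T.nodes \ {t', s'}) ∪ {t, s}, n ∈ D.nodes := by
    rintro n (⟨h1, h2⟩ | h)
    · simp only [Set.mem_insert_iff, Set.mem_singleton_iff, not_or] at h2
      exact hTD n h1 h2.1 h2.2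
    · rcases h with rfl | rfl
      · exact htD
      · exact hsD
  have old : ∀ n ∈ T.nodes, n ≠ t' → n ≠ s' → n ∈ (T.nodes \ {t', s'}) ∪ {t, s} := by
    intro n h1 h2 h3
    exact Or.inl ⟨h1, by simp [h2, h3]⟩
  have tm : t ∈ (T.nodes \ {t', s'}) ∪ {t, s} := by simp
  have sm : s ∈ (T.nodes \ {t', s'}) ∪ {t, s} := by simp
  have hedge : ∀ e ∈ {e ∈ T.edges | e.1 ≠ t' ∧ e.1 ≠ s' ∧ e.2 ≠ t' ∧ e.2 ≠ s'} ∪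
        {(u, t), (t, s), (t, z), (s, x), (s, y)},
      e.1 ∈ (T.nodes \ {t', s'}) ∪ {t, s} ∧ e.2 ∈ (T.nodes \ {t', s'}) ∪ {t, s} ∧
        CompatibleChild e.1 e.2 := by
    rintro e (⟨h1, h2, h3, h4, h5⟩ | h)
    · obtain ⟨a, b, c⟩ := hE _ h1
      exact ⟨old _ a h2 h3, old _ b h4 h5, c⟩
    · rcases h with rfl | rfl | rfl | rfl | rfl
      · exact ⟨old _ nu hut hus, tm, by rw [ut]; exact (hE _ eu).2.2.1,
          fun h => htN (by dsimp only at h nu; rw [h]; exact nu)⟩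
      · exact ⟨tm, sm, by dsimp only; rw [us, ht]; simp, hts.symm⟩
      · exact ⟨tm, old _ nz hzt hzs, by dsimp only; rw [uz, ht]; simp,
          fun h => htN (by dsimp only at h nz; rw [← h]; exact nz)⟩
      · exact ⟨sm, old _ nx hxt hxs, by dsimp only; rw [ux, hs]; simp,
          fun h => hsN (by dsimp only at h nx; rw [← h]; exact nx)⟩
      · exact ⟨sm, old _ ny hyt hys, by dsimp only; rw [uy, hs]; simp,
          fun h => hsN (by dsimp only at h ny; rw [← h]; exact ny)⟩
  have medge : ∀ p q, (p, q) ∈ ({e ∈ T.edges | e.1 ≠ t' ∧ e.1 ≠ s' ∧ e.2 ≠ t' ∧ e.2 ≠ s'} ∪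
        {(u, t), (t, s), (t, z), (s, x), (s, y)} : Set (SNode α × SNode α)) ↔
      ((p, q) ∈ T.edges ∧ p ≠ t' ∧ p ≠ s' ∧ q ≠ t' ∧ q ≠ s') ∨ (p = u ∧ q = t) ∨
        (p = t ∧ q = s) ∨ (p = t ∧ q = z) ∨ (p = s ∧ q = x) ∨ (p = s ∧ q = y) := by
    intro p q
    simp only [Set.mem_union, Set.mem_setOf_eq, Set.mem_insert_iff, Set.mem_singleton_iff,
      Prod.mk.injEq]
  have huN : u ≠ t ∧ u ≠ s := ⟨fun h => htN (h ▸ nu), fun h => hsN (h ▸ nu)⟩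
  have hyN : y ≠ t ∧ y ≠ s := ⟨fun h => htN (h ▸ ny), fun h => hsN (h ▸ ny)⟩
  have hxN : x ≠ t ∧ x ≠ s := ⟨fun h => htN (h ▸ nx), fun h => hsN (h ▸ nx)⟩
  have hzN : z ≠ t ∧ z ≠ s := ⟨fun h => htN (h ▸ nz), fun h => hsN (h ▸ nz)⟩
  have hxy : x ≠ y := fun h => hAB (by rw [← ux, ← uy, h])
  have hxz : x ≠ z := fun h => hAC (by rw [← ux, ← uz, h])
  have hyz : y ≠ z := fun h => hBC (by rw [← uy, ← uz, h])
  have eN : ∀ p q, (p, q) ∈ T.edges → p ∈ T.nodes ∧ q ∈ T.nodes :=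
    fun p q h => ⟨(hE _ h).1, (hE _ h).2.1⟩
  refine ⟨⟨⟨?_, ?_, ?_, hedge⟩, ?_, ?_⟩, hnodes, ?_⟩
  · exact old _ hR (fun h => by have := card1 X; rw [h] at this; omega)
      (fun h => by have := card1 X; rw [h] at this; omega)
  · intro a ha
    exact old _ (hL a ha) (fun h => by have := card1 {a}; rw [h] at this; omega)
      (fun h => by have := card1 {a}; rw [h] at this; omega)
  · intro n hn
    exact hD.2.2.1 n (hnodes n hn)
  · intro n hn hleaf K hK
    dsimp only
    simp only [medge]
    rcases hn with ⟨h1, h2⟩ | h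
    · simp only [Set.mem_insert_iff, Set.mem_singleton_iff, not_or] at h2
      obtain ⟨c, ⟨hc1, hc2⟩, hc3⟩ := hC n h1 hleaf K hK
      dsimp only at hc3
      have hnt : n ≠ t := fun h => htN (h ▸ h1)
      have hns : n ≠ s := fun h => hsN (h ▸ h1)
      by_cases hct : c = t'
      · subst hct
        have hnu : n = u := par _ _ _ hc1 eu
        refine ⟨t, ⟨Or.inr (Or.inl ⟨hnu, rfl⟩), ut.trans hc2⟩, ?_⟩
        grind
      · have hcs : c ≠ s' := by
          rintro rfl
          exact h2.1 (par _ _ _ hc1 ets)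
        refine ⟨c, ⟨Or.inl ⟨hc1, h2.1, h2.2, hct, hcs⟩, hc2⟩, ?_⟩
        grind
    · rcases h with h | h
      · rw [h] at hK ⊢
        rw [ht] at hK
        simp only [Finset.mem_insert, Finset.mem_singleton] at hK
        rcases hK with rfl | rfl
        · refine ⟨s, ⟨by simp, us⟩, ?_⟩
          grind
        · refine ⟨z, ⟨by simp, uz⟩, ?_⟩
          grind
      · have h : n = s := h
        rw [h] at hK ⊢
        rw [hs] at hK
        simp only [Finset.mem_insert, Finset.mem_singleton] at hK
        rcases hK with rfl | rfl
        · refine ⟨x, ⟨by simp, ux⟩, ?_⟩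
          grind
        · refine ⟨y, ⟨by simp, uy⟩, ?_⟩
          grind
  · intro n hn hroot
    dsimp only
    simp only [medge]
    rcases hn with ⟨h1, h2⟩ | h
    · simp only [Set.mem_insert_iff, Set.mem_singleton_iff, not_or] at h2
      obtain ⟨p, hp, -⟩ := hP n h1 hroot
      have hnt : n ≠ t := fun h => htN (h ▸ h1)
      have hns : n ≠ s := fun h => hsN (h ▸ h1)
      by_cases hpt : p = t'
      · subst hpt
        have hny : n = y := (cht n hp).resolve_left h2.2
        refine ⟨s, by simp [hny], ?_⟩
        grind
      · by_cases hps : p = s'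
        · subst hps
          rcases chs n hp with hn | hn
          · refine ⟨s, by simp [hn], ?_⟩
            grind
          · refine ⟨t, by simp [hn], ?_⟩
            grind
        · refine ⟨p, Or.inl ⟨hp, hpt, hps, h2.1, h2.2⟩, ?_⟩
          grind
    · rcases h with h | h
      · refine ⟨u, by simp [h], ?_⟩
        grind
      · have h : n = s := h
        refine ⟨t, by simp [h], ?_⟩
        grind
  · intro e he
    obtain ⟨h1, h2, h3⟩ := hedge e he
    exact hall _ (hnodes _ h1) _ (hnodes _ h2) h3

end Phylo

namespace Phylo

/-- Let `D` have all compatible edges, apply the NNI at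
`t → s = ({A ∪ B, C}, {A, B})` swapping `B` and `C`, and let `τ'` be a topology
in the post-NNI sDAG containing the central edge `t' → s'`, with neighboring
edges `u → t'`, `t' → y`, `s' → x`, `s' → z` in `τ'` (where `∪(y) = B`,
`∪(x) = A`, `∪(z) = C`).  Then the graph `τ` obtained from `τ'` by removing `t'`
and `s'` and their incident edges and adding the nodes `t`, `s` and the edges
`u → t`, `t → s`, `t → z`, `s → x`, `s → y` is a topology in `D`, and `τ'` is
an NNI of `τ`. -/
theorem statement_8 {α : Type*} [DecidableEq α] (X : Finset α) (D : Digraph α)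
    (hD : IsSDag X D) (hall : AllCompatibleEdges D)
    (A B C : Finset α) (hnni : NNIApplicable D A B C)
    (τ' : Digraph α)
    (hτ' : IsTopologyIn X (nniEnlarge D A B C) τ')
    (hcentral : (({A ∪ C, B} : SNode α), ({A, C} : SNode α)) ∈ τ'.edges)
    (u x y z : SNode α)
    (hu : (u, ({A ∪ C, B} : SNode α)) ∈ τ'.edges)
    (hy : (({A ∪ C, B} : SNode α), y) ∈ τ'.edges) (hyB : cladeUnion y = B)
    (hx : (({A, C} : SNode α), x) ∈ τ'.edges) (hxA : cladeUnion x = A)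
    (hz : (({A, C} : SNode α), z) ∈ τ'.edges) (hzC : cladeUnion z = C) :
    let τ : Digraph α :=
      ⟨(τ'.nodes \ {({A ∪ C, B} : SNode α), ({A, C} : SNode α)}) ∪
          {({A ∪ B, C} : SNode α), ({A, B} : SNode α)},
        {e ∈ τ'.edges | e.1 ≠ ({A ∪ C, B} : SNode α) ∧ e.1 ≠ ({A, C} : SNode α) ∧
            e.2 ≠ ({A ∪ C, B} : SNode α) ∧ e.2 ≠ ({A, C} : SNode α)} ∪
          {(u, ({A ∪ B, C} : SNode α)),
            (({A ∪ B, C} : SNode α), ({A, B} : SNode α)),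
            (({A ∪ B, C} : SNode α), z),
            (({A, B} : SNode α), x),
            (({A, B} : SNode α), y)}⟩
    IsTopologyIn X D τ ∧ IsNNIOf τ' τ := by
  intro τ
  obtain ⟨⟨hT, hsubN, hsubE⟩⟩ : Nonempty (IsTopology X τ' ∧ τ'.nodes ⊆ (nniEnlarge D A B C).nodes ∧
    τ'.edges ⊆ (nniEnlarge D A B C).edges) := ⟨hτ'.1, hτ'.2.1, hτ'.2.2⟩
  obtain ⟨hA, hB, hC, dAB, dAC, dBC, hedge⟩ := hnni
  obtain ⟨a, ha⟩ := hA
  obtain ⟨b, hb⟩ := hB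
  obtain ⟨c, hc⟩ := hC
  have dAB' := Finset.disjoint_left.1 dAB
  have dAC' := Finset.disjoint_left.1 dAC
  have dBC' := Finset.disjoint_left.1 dBC
  have nAB : A ≠ B := fun h => dAB' ha (h ▸ ha)
  have nAC : A ≠ C := fun h => dAC' ha (h ▸ ha)
  have nBC : B ≠ C := fun h => dBC' hb (h ▸ hb)
  have nABC : A ∪ B ≠ C := fun h => dAC' ha (h ▸ Finset.mem_union_left _ ha)
  have nACB : A ∪ C ≠ B := fun h => dAB' ha (h ▸ Finset.mem_union_left _ ha)
  have nACBC : A ∪ B ≠ A ∪ C := by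
    intro h
    have : b ∈ A ∪ C := h ▸ Finset.mem_union_right _ hb
    rcases Finset.mem_union.1 this with h | h
    · exact dAB' h hb
    · exact dBC' hb h
  have nACA : A ≠ A ∪ C := by
    intro h
    have : c ∈ A := by rw [h]; exact Finset.mem_union_right _ hc
    exact dAC' this hc
  have nABA : A ≠ A ∪ B := by
    intro h
    have : b ∈ A := by rw [h]; exact Finset.mem_union_right _ hb
    exact dAB' this hb
  have ut : cladeUnion ({A ∪ B, C} : SNode α) = A ∪ B ∪ C := cladeUnion_pair _ _
  have ut' : cladeUnion ({A ∪ C, B} : SNode α) = A ∪ B ∪ C := by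
    rw [cladeUnion_pair, Finset.union_right_comm]
  have us : cladeUnion ({A, B} : SNode α) = A ∪ B := cladeUnion_pair _ _
  have us' : cladeUnion ({A, C} : SNode α) = A ∪ C := cladeUnion_pair _ _
  have nt : ({A ∪ B, C} : SNode α).card = 2 := Finset.card_pair nABC
  have nt' : ({A ∪ C, B} : SNode α).card = 2 := Finset.card_pair nACB
  have ns : ({A, B} : SNode α).card = 2 := Finset.card_pair nAB
  have ns' : ({A, C} : SNode α).card = 2 := Finset.card_pair nAC
  have mt : ∀ K, K ∈ ({A ∪ B, C} : SNode α) ↔ K = A ∪ B ∨ K = C := by simp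
  have mt' : ∀ K, K ∈ ({A ∪ C, B} : SNode α) ↔ K = A ∪ C ∨ K = B := by simp
  have ms : ∀ K, K ∈ ({A, B} : SNode α) ↔ K = A ∨ K = B := by simp
  have ms' : ∀ K, K ∈ ({A, C} : SNode α) ↔ K = A ∨ K = C := by simp
  have notroot : ∀ n : SNode α, n.card = 2 → n ≠ {X} := by
    rintro n h rfl
    simp at h
  have lam := fun m n hm hn hmr hnr ham han =>
    laminar hT a (2 * X.card) m n hm hn hmr hnr ham han (by omega)
  have Nt' := (hT.1.2.2.2 _ hu).2.1
  have Ns' := (hT.1.2.2.2 _ hx).1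
  dsimp only at Nt' Ns'
  have htD := (hD.2.2.2 _ hedge).1
  have hsD := (hD.2.2.2 _ hedge).2.1
  dsimp only at htD hsD
  have htN : ({A ∪ B, C} : SNode α) ∉ τ'.nodes := by
    intro h
    rcases lam _ _ h Nt' (notroot _ nt) (notroot _ nt') (by rw [ut]; simp [ha])
      (by rw [ut']; simp [ha]) with h | ⟨K, hK, h⟩ | ⟨K, hK, h⟩
    · have : A ∪ B ∈ ({A ∪ C, B} : SNode α) := by rw [← h]; simp
      rw [mt'] at this
      rcases this with h | h
      · exact nACBC h
      · exact dAB' ha (h ▸ Finset.mem_union_left _ ha)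
    · rw [ut] at h
      rw [mt'] at hK
      have h1 : a ∈ K := h (by simp [ha])
      have h2 : b ∈ K := h (by simp [hb])
      rcases hK with rfl | rfl <;> grind
    · rw [ut'] at h
      rw [mt] at hK
      have h1 : a ∈ K := h (by simp [ha])
      have h2 : c ∈ K := h (by simp [hc])
      rcases hK with rfl | rfl <;> grind
  have hsN : ({A, B} : SNode α) ∉ τ'.nodes := by
    intro h
    rcases lam _ _ h Ns' (notroot _ ns) (notroot _ ns') (by rw [us]; simp [ha])
      (by rw [us']; simp [ha]) with h | ⟨K, hK, h⟩ | ⟨K, hK, h⟩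
    · have : B ∈ ({A, C} : SNode α) := by rw [← h]; simp
      rw [ms'] at this
      rcases this with h | h
      · exact nAB h.symm
      · exact nBC h
    · rw [us] at h
      rw [ms'] at hK
      have h1 : a ∈ K := h (by simp [ha])
      have h2 : b ∈ K := h (by simp [hb])
      rcases hK with rfl | rfl <;> grind
    · rw [us'] at h
      rw [ms] at hK
      have h1 : a ∈ K := h (by simp [ha])
      have h2 : c ∈ K := h (by simp [hc])
      rcases hK with rfl | rfl <;> grind
  have huc : ∀ p m n, (p, m) ∈ τ'.edges → (p, n) ∈ τ'.edges → cladeUnion m = cladeUnion n →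
      m = n := by
    intro p m n h1 h2 h3
    obtain ⟨hp, hm, hc⟩ := hT.1.2.2.2 _ h1
    have hl : ¬ IsLeafNode p := fun hl => no_leaf_child hl (hT.1.2.2.1 _ hm) hc
    exact (hT.2.1 p hp hl _ hc.1).unique ⟨h1, rfl⟩ ⟨h2, h3.symm⟩
  have par : ∀ p q w, (p, w) ∈ τ'.edges → (q, w) ∈ τ'.edges → p = q := by
    intro p q w h1 h2
    obtain ⟨hp, hw, hc⟩ := hT.1.2.2.2 _ h1
    obtain ⟨hq, -, hc'⟩ := hT.1.2.2.2 _ h2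
    dsimp only at hp hw hc hq hc'
    by_cases hr : w = {X}
    · have uw : cladeUnion w = X := by rw [hr]; simp [cladeUnion]
      exfalso
      have hpr : p ≠ {X} := fun h => hc.2 (hr.trans h.symm)
      have h1 := parent_lt (hT.1.2.2.1 _ hp) (hT.1.2.2.1 _ hw) hc hpr
      have h2 := Finset.card_le_card (cladeUnion_subset (hT.1.2.2.1 _ hp))
      have h3 := Finset.card_lt_card h1
      rw [uw] at h3
      omega
    · exact (hT.2.2 w hw hr).unique h1 h2
  have cht : ∀ w, (({A ∪ C, B} : SNode α), w) ∈ τ'.edges → w = {A, C} ∨ w = y := by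
    intro w hw
    have h := (hT.1.2.2.2 _ hw).2.2.1
    dsimp only at h
    rw [mt'] at h
    rcases h with h | h
    · exact Or.inl (huc _ _ _ hw hcentral (h.trans us'.symm))
    · exact Or.inr (huc _ _ _ hw hy (h.trans hyB.symm))
  have chs : ∀ w, (({A, C} : SNode α), w) ∈ τ'.edges → w = x ∨ w = z := by
    intro w hw
    have h := (hT.1.2.2.2 _ hw).2.2.1
    dsimp only at h
    rw [ms'] at h
    rcases h with h | h
    · exact Or.inl (huc _ _ _ hw hx (h.trans hxA.symm))
    · exact Or.inr (huc _ _ _ hw hz (h.trans hzC.symm))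
  have hts : ({A ∪ B, C} : SNode α) ≠ {A, B} := by
    intro h
    have := congrArg cladeUnion h
    rw [ut, us] at this
    have hc' : c ∈ A ∪ B := by rw [← this]; simp [hc]
    grind
  have hut : u ≠ {A ∪ C, B} := fun h => (hT.1.2.2.2 _ hu).2.2.2 h.symm
  have hus : u ≠ {A, C} := by
    intro h
    have h' := (hT.1.2.2.2 _ hu).2.2.1
    dsimp only at h'
    rw [h, ut', ms'] at h'
    have hm : b ∈ A ∪ B ∪ C := by simp [hb]
    rcases h' with h' | h' <;> rw [h'] at hm <;> grind
  have sep : ∀ w : SNode α, cladeUnion w = A ∨ cladeUnion w = B ∨ cladeUnion w = C →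
      w ≠ {A ∪ C, B} ∧ w ≠ {A, C} := by
    intro w hw
    constructor
    · rintro rfl
      rw [ut'] at hw
      have h1 : a ∈ A ∪ B ∪ C := by simp [ha]
      have h2 : b ∈ A ∪ B ∪ C := by simp [hb]
      rcases hw with h | h | h <;> rw [h] at h1 h2 <;> grind
    · rintro rfl
      rw [us'] at hw
      have h1 : a ∈ A ∪ C := by simp [ha]
      have h2 : c ∈ A ∪ C := by simp [hc]
      rcases hw with h | h | h <;> rw [h] at h1 h2 <;> grind
  have sx := sep x (Or.inl hxA)
  have sy := sep y (Or.inr (Or.inl hyB))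
  have sz := sep z (Or.inr (Or.inr hzC))
  have hTD : ∀ n ∈ τ'.nodes, n ≠ ({A ∪ C, B} : SNode α) → n ≠ ({A, C} : SNode α) →
      n ∈ D.nodes := by
    intro n hn h1 h2
    rcases hsubN hn with h | h | h
    · exact h
    · exact absurd h h1
    · exact absurd h h2
  refine ⟨core X D hD hall τ' hT {A ∪ B, C} {A, B} {A ∪ C, B} {A, C} u x y z A B C hTD htD hsD
    htN hsN hts rfl rfl (ut.trans ut'.symm) us nt' ns' nt ns nAB nAC nBC nABC hxA hyB hzC
    hcentral hu hy hx hz cht chs par hus hut sy.1 sy.2 sx.1 sx.2 sz.1 sz.2, ?_⟩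
  refine ⟨A, B, C, ⟨a, ha⟩, ⟨b, hb⟩, ⟨c, hc⟩, dAB, dAC, dBC, by simp [τ], ?_⟩
  have subs : ∀ P Q : Finset α, ∀ p, p ∈ P → p ∉ Q → ¬ P ⊆ Q := fun P Q p h1 h2 h3 => h2 (h3 h1)
  have sBA : ¬ B ⊆ A := fun h => dAB' (h hb) hb
  have sAB : ¬ A ⊆ B := fun h => dAB' ha (h ha)
  have sABC : ¬ A ∪ B ⊆ C := fun h => dAC' ha (h (Finset.mem_union_left _ ha))
  have nx := (hT.1.2.2.2 _ hx).2.1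
  have ny := (hT.1.2.2.2 _ hy).2.1
  have nz := (hT.1.2.2.2 _ hz).2.1
  have nu := (hT.1.2.2.2 _ hu).1
  have eN : ∀ p q, (p, q) ∈ τ'.edges → p ∈ τ'.nodes ∧ q ∈ τ'.nodes :=
    fun p q h => ⟨(hT.1.2.2.2 _ h).1, (hT.1.2.2.2 _ h).2.1⟩
  have hnodes : τ'.nodes = (nniSwapTop τ A B C).nodes := by
    ext n
    simp only [nniSwapTop, τ, Set.mem_union, Set.mem_diff, Set.mem_insert_iff,
      Set.mem_singleton_iff]
    grind
  have hedges : τ'.edges = (nniSwapTop τ A B C).edges := by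
    ext ⟨p, q⟩
    simp only [nniSwapTop, τ, Set.mem_union, Set.mem_setOf_eq, Set.mem_insert_iff,
      Set.mem_singleton_iff, Prod.mk.injEq]
    generalize ht : ({A ∪ B, C} : SNode α) = t at *
    generalize hs : ({A, B} : SNode α) = s at *
    generalize ht' : ({A ∪ C, B} : SNode α) = t' at *
    generalize hs' : ({A, C} : SNode α) = s' at *
    dsimp only at nx ny nz nu
    have huN : u ≠ t ∧ u ≠ s := ⟨fun h => htN (h ▸ nu), fun h => hsN (h ▸ nu)⟩
    have hyN : y ≠ t ∧ y ≠ s := ⟨fun h => htN (h ▸ ny), fun h => hsN (h ▸ ny)⟩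
    have hxN : x ≠ t ∧ x ≠ s := ⟨fun h => htN (h ▸ nx), fun h => hsN (h ▸ nx)⟩
    have hzN : z ≠ t ∧ z ≠ s := ⟨fun h => htN (h ▸ nz), fun h => hsN (h ▸ nz)⟩
    have et : ∀ p, (p, t) ∉ τ'.edges := fun p h => htN (eN _ _ h).2
    have et2 : ∀ p, (t, p) ∉ τ'.edges := fun p h => htN (eN _ _ h).1
    have es : ∀ p, (p, s) ∉ τ'.edges := fun p h => hsN (eN _ _ h).2
    have es2 : ∀ p, (s, p) ∉ τ'.edges := fun p h => hsN (eN _ _ h).1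
    clear ht hs ht' hs' lam mt mt' ms ms' sep subs hsubE hsubN hτ'
    constructor
    · intro h
      by_cases h1 : p = t'
      · subst h1
        rcases cht q h with h2 | h2
        · exact Or.inr (Or.inl ⟨rfl, h2⟩)
        · refine Or.inr (Or.inr (Or.inr (Or.inr (Or.inl ⟨q, ?_, ?_, rfl, rfl⟩))))
          · simp [h2]
          · rw [h2, hyB]
      by_cases h2 : p = s'
      · subst h2
        rcases chs q h with h2 | h2
        · refine Or.inr (Or.inr (Or.inr (Or.inl ⟨q, ?_, ?_, rfl, rfl⟩)))
          · simp [h2]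
          · rw [h2, hxA]
        · refine Or.inr (Or.inr (Or.inr (Or.inr (Or.inr ⟨q, ?_, ?_, rfl, rfl⟩))))
          · simp [h2]
          · rw [h2, hzC]
      by_cases h3 : q = t'
      · subst h3
        have := par _ _ _ h hu
        exact Or.inr (Or.inr (Or.inl ⟨p, by simp [this], rfl, rfl⟩))
      by_cases h4 : q = s'
      · subst h4
        exact absurd (par _ _ _ h hcentral) h1
      left
      refine ⟨Or.inl ⟨h, h1, h2, h3, h4⟩, ?_, ?_, ?_, ?_⟩ <;> grind
    · rintro (⟨h, h1, h2, h3, h4⟩ | ⟨rfl, rfl⟩ | ⟨v, h, rfl, rfl⟩ | ⟨v, h, h1, rfl, rfl⟩ |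
        ⟨v, h, h1, rfl, rfl⟩ | ⟨v, h, h1, rfl, rfl⟩)
      · grind
      · exact hcentral
      · grind
      · grind
      · grind
      · grind
  generalize nniSwapTop τ A B C = T2 at hnodes hedges
  cases T2
  cases τ'
  simp only at hnodes hedges
  subst hnodes hedges
  rfl

end Phylo
end

section
/- Let D₀ be the sDAG generated by the three rooted topologies on taxa {0,1,...,10}: τ₁ = (0,(((((1,(2,3)),(4,5)),(6,(7,8))),9),10)), τ₂ = (0,(((1,((2,6),((3,7),8))),(4,5)),(9,10))), and τ₃ = (0,((((((((1,2),3)),((6,7),8)),4),5),10),9)). Let D₀' be the sDAG obtained from D₀ by the NNI swapping the clades {4,5} and {6,7,8} at the edge from the subsplit {{1,2,3,4,5},{6,7,8}} to the subsplit {{1,2,3},{4,5}}, whose central edge goes from {{1,2,3,6,7,8},{4,5}} to {{1,2,3},{6,7,8}}. Then the topology (0,((((1,((2,6),((3,7),8))),(4,5)),9),10)) is a topology in D₀' that is not a topology in D₀, and it does not contain the central edge. -/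
namespace Phylo

/-- τ₁ = (0,(((((1,(2,3)),(4,5)),(6,(7,8))),9),10)) -/
def tau1 : BT ℕ :=
  .nd (.lf 0)
    (.nd
      (.nd
        (.nd
          (.nd (.nd (.lf 1) (.nd (.lf 2) (.lf 3))) (.nd (.lf 4) (.lf 5)))
          (.nd (.lf 6) (.nd (.lf 7) (.lf 8))))
        (.lf 9))
      (.lf 10))

/-- τ₂ = (0,(((1,((2,6),((3,7),8))),(4,5)),(9,10))) -/
def tau2 : BT ℕ :=
  .nd (.lf 0)
    (.nd
      (.nd
        (.nd (.lf 1) (.nd (.nd (.lf 2) (.lf 6)) (.nd (.nd (.lf 3) (.lf 7)) (.lf 8))))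
        (.nd (.lf 4) (.lf 5)))
      (.nd (.lf 9) (.lf 10)))

/-- τ₃ = (0,((((((((1,2),3)),((6,7),8)),4),5),10),9)) -/
def tau3 : BT ℕ :=
  .nd (.lf 0)
    (.nd
      (.nd
        (.nd
          (.nd
            (.nd (.nd (.nd (.lf 1) (.lf 2)) (.lf 3)) (.nd (.nd (.lf 6) (.lf 7)) (.lf 8)))
            (.lf 4))
          (.lf 5))
        (.lf 10))
      (.lf 9))

/-- The sDAG generated by τ₁, τ₂ and τ₃. -/
def D0 : Digraph ℕ :=
  Digraph.union (Digraph.union (BT.toDigraph tau1) (BT.toDigraph tau2)) (BT.toDigraph tau3)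

end Phylo

namespace Phylo

/-- The topology (0,((((1,((2,6),((3,7),8))),(4,5)),9),10)). -/
def tauW : BT ℕ :=
  .nd (.lf 0)
    (.nd
      (.nd
        (.nd
          (.nd (.lf 1) (.nd (.nd (.lf 2) (.lf 6)) (.nd (.nd (.lf 3) (.lf 7)) (.lf 8))))
          (.nd (.lf 4) (.lf 5)))
        (.lf 9))
      (.lf 10))

/-- The nodes of a tree, as a list. -/
def BT.nodesL : BT ℕ → List (SNode ℕ)
  | .lf x => [({({x} : Finset ℕ)} : SNode ℕ)]
  | .nd l r => ({l.taxa, r.taxa} : SNode ℕ) :: (BT.nodesL l ++ BT.nodesL r)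

/-- The edges of a tree, as a list. -/
def BT.edgesL : BT ℕ → List (SNode ℕ × SNode ℕ)
  | .lf _ => []
  | .nd l r => (({l.taxa, r.taxa} : SNode ℕ), l.subsplit) ::
      (({l.taxa, r.taxa} : SNode ℕ), r.subsplit) :: (BT.edgesL l ++ BT.edgesL r)

theorem BT.mem_nodesL (t : BT ℕ) (n : SNode ℕ) : n ∈ t.sdagNodes ↔ n ∈ t.nodesL := by
  induction t with
  | lf x => simp [BT.sdagNodes, BT.nodesL]
  | nd l r hl hr => simp [BT.sdagNodes, BT.nodesL, hl, hr]

theorem BT.mem_edgesL (t : BT ℕ) (e : SNode ℕ × SNode ℕ) :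
    e ∈ t.sdagEdges ↔ e ∈ t.edgesL := by
  induction t with
  | lf x => simp [BT.sdagEdges, BT.edgesL]
  | nd l r hl hr =>
    simp only [BT.sdagEdges, BT.edgesL, Set.mem_insert_iff, Set.mem_union, hl, hr,
      List.mem_cons, List.mem_append]

/-- Nodes of the digraph of a tree, as a list. -/
def BT.nodesR (t : BT ℕ) : List (SNode ℕ) := ({t.taxa} : SNode ℕ) :: t.nodesL

/-- Edges of the digraph of a tree, as a list. -/
def BT.edgesR (t : BT ℕ) : List (SNode ℕ × SNode ℕ) :=
  (({t.taxa} : SNode ℕ), t.subsplit) :: t.edgesL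

theorem BT.mem_nodesR (t : BT ℕ) (n : SNode ℕ) : n ∈ t.toDigraph.nodes ↔ n ∈ t.nodesR := by
  simp only [BT.toDigraph, BT.nodesR, Set.mem_insert_iff, BT.mem_nodesL, List.mem_cons]

theorem BT.mem_edgesR (t : BT ℕ) (e : SNode ℕ × SNode ℕ) :
    e ∈ t.toDigraph.edges ↔ e ∈ t.edgesR := by
  simp only [BT.toDigraph, BT.edgesR, Set.mem_insert_iff, BT.mem_edgesL, List.mem_cons]

theorem mem_D0_nodes (n : SNode ℕ) :
    n ∈ D0.nodes ↔ n ∈ tau1.nodesR ++ tau2.nodesR ++ tau3.nodesR := by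
  simp only [D0, Digraph.union, Set.mem_union, BT.mem_nodesR, List.mem_append]

theorem mem_D0_edges (e : SNode ℕ × SNode ℕ) :
    e ∈ D0.edges ↔ e ∈ tau1.edgesR ++ tau2.edgesR ++ tau3.edgesR := by
  simp only [D0, Digraph.union, Set.mem_union, BT.mem_edgesR, List.mem_append]

instance : DecidableRel (CompatibleChild (α := ℕ)) := fun t s =>
  inferInstanceAs (Decidable (cladeUnion s ∈ t ∧ s ≠ t))

theorem tauW_valid : ∀ t ∈ tauW.nodesR,
    (∀ A ∈ t, A ⊆ Finset.range 11) ∧ (∀ A ∈ t, A.Nonempty) ∧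
    (∀ A ∈ t, ∀ B ∈ t, A ≠ B → Disjoint A B) ∧ (t.card = 1 ∨ t.card = 2) ∧
    (t.card = 1 → t = ({Finset.range 11} : SNode ℕ) ∨
      ∃ x ∈ Finset.range 11, t = ({({x} : Finset ℕ)} : SNode ℕ)) := by
  decide +kernel

theorem tauW_sdag : IsSDag (Finset.range 11) tauW.toDigraph := by
  simp only [IsSDag, BT.mem_nodesR, BT.mem_edgesR]
  refine ⟨by decide +kernel, by decide +kernel, ?_, by decide +kernel⟩
  intro t ht
  obtain ⟨h1, h2, h3, h4, h5⟩ := tauW_valid t ht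
  exact ⟨h1, h2, h3, h4, fun h => (h5 h).imp id fun ⟨x, _, hx⟩ => ⟨x, hx⟩⟩

theorem tauW_children : ∀ t ∈ tauW.nodesR,
    (∃ x ∈ Finset.range 11, t = ({({x} : Finset ℕ)} : SNode ℕ)) ∨
    ∀ C ∈ t, ∃ e ∈ tauW.edgesR, e.1 = t ∧ cladeUnion e.2 = C ∧
      ∀ e' ∈ tauW.edgesR, e'.1 = t → cladeUnion e'.2 = C → e'.2 = e.2 := by
  decide +kernel

theorem tauW_parents : ∀ s ∈ tauW.nodesR, s ≠ ({Finset.range 11} : SNode ℕ) →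
    ∃ e ∈ tauW.edgesR, e.2 = s ∧ ∀ e' ∈ tauW.edgesR, e'.2 = s → e'.1 = e.1 := by
  decide +kernel

theorem tauW_topology : IsTopology (Finset.range 11) tauW.toDigraph := by
  refine ⟨tauW_sdag, ?_, ?_⟩
  · simp only [BT.mem_nodesR, BT.mem_edgesR]
    intro t ht hl C hC
    rcases tauW_children t ht with ⟨x, _, hx⟩ | h
    · exact absurd ⟨x, hx⟩ hl
    · obtain ⟨⟨a, b⟩, he, rfl, h2, h3⟩ := h C hC
      exact ⟨b, ⟨he, h2⟩, fun y hy => h3 _ hy.1 rfl hy.2⟩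
  · simp only [BT.mem_nodesR, BT.mem_edgesR]
    intro s hs hne
    obtain ⟨⟨a, b⟩, he, rfl, h3⟩ := tauW_parents s hs hne
    exact ⟨a, he, fun y hy => h3 _ hy rfl⟩

theorem tauW_nodes_sub : ∀ n ∈ tauW.nodesR,
    n ∈ tau1.nodesR ++ tau2.nodesR ++ tau3.nodesR := by
  decide +kernel

theorem tauW_edges_sub : ∀ e ∈ tauW.edgesR,
    e ∈ tau1.edgesR ++ tau2.edgesR ++ tau3.edgesR ∨
    ((e.1, ({({1, 2, 3} : Finset ℕ) ∪ {4, 5}, {6, 7, 8}} : SNode ℕ)) ∈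
        tau1.edgesR ++ tau2.edgesR ++ tau3.edgesR ∧
      e.2 = ({({1, 2, 3} : Finset ℕ) ∪ {6, 7, 8}, {4, 5}} : SNode ℕ)) := by
  decide +kernel

theorem tauW_not_sub : ¬ ∀ e ∈ tauW.edgesR,
    e ∈ tau1.edgesR ++ tau2.edgesR ++ tau3.edgesR := by
  decide +kernel

/-- Let `D₀'` be obtained from `D₀` by the NNI swapping `{4,5}` and
`{6,7,8}` at the edge `{{1,2,3,4,5},{6,7,8}} → {{1,2,3},{4,5}}`, whose central edge
is `{{1,2,3,6,7,8},{4,5}} → {{1,2,3},{6,7,8}}`.  Then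
(0,((((1,((2,6),((3,7),8))),(4,5)),9),10)) is a topology in `D₀'` that is not a
topology in `D₀`, and it does not contain the central edge. -/
theorem statement_12 :
    IsTopologyIn (Finset.range 11)
        (nniEnlarge D0 ({1, 2, 3} : Finset ℕ) ({4, 5} : Finset ℕ) ({6, 7, 8} : Finset ℕ))
        (BT.toDigraph tauW) ∧
      ¬ IsTopologyIn (Finset.range 11) D0 (BT.toDigraph tauW) ∧
      ((({({1, 2, 3} : Finset ℕ) ∪ ({6, 7, 8} : Finset ℕ), ({4, 5} : Finset ℕ)} : SNode ℕ),
          ({({1, 2, 3} : Finset ℕ), ({6, 7, 8} : Finset ℕ)} : SNode ℕ)) ∉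
        (BT.toDigraph tauW).edges) := by
  refine ⟨⟨tauW_topology, ?_, ?_⟩, ?_, ?_⟩
  · intro n hn
    exact Or.inl ((mem_D0_nodes n).2 (tauW_nodes_sub n ((BT.mem_nodesR _ _).1 hn)))
  · rintro ⟨a, b⟩ he
    rcases tauW_edges_sub _ ((BT.mem_edgesR _ _).1 he) with h | ⟨h1, h2⟩
    · exact Or.inl ((mem_D0_edges _).2 h)
    · exact Or.inr (Or.inr (Or.inl ⟨a, (mem_D0_edges _).2 h1, Prod.ext rfl h2⟩))
  · rintro ⟨_, _, h⟩
    exact tauW_not_sub fun e he =>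
      (mem_D0_edges e).1 (h ((BT.mem_edgesR _ _).2 he))
  · rw [BT.mem_edgesR]
    decide +kernel

end Phylo
end
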